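/- Suppose each buyer has ρ_i ∈ (−∞, 0]: buyers with −∞ < ρ_i < 0 update by b_ij^{t+1} = e_i · (a_ij/p_j(b^t)^{ρ_i})^{1/(1−ρ_i)} / Σ_k (a_ik/p_k(b^t)^{ρ_i})^{1/(1−ρ_i)}, and buyers with ρ_i = 0 update to b_ij^{t+1} = e_i·a_ij (their equilibrium spending b*_ij = e_i a_ij), starting from an entrywise positive feasible b^0 (so there is no buyer with a Leontief utility). Let σ = min_{i: ρ_i<0} (ρ_i − 1)/ρ_i > 1 and let b*_{<0} be the maximizer of Φ(b*_{=0}, ·) over feasible spendings of the ρ_i < 0 buyers. Then for all T ≥ 1: Φ(b*_{=0}, b*_{<0}) − Φ(b*_{=0}, b^T_{<0}) ≤ ( (σ − 1)/(σ^T − 1) )·( Σ_{i: ρ_i=0} KL(b_i* ‖ b_i^0) + Σ_{i: ρ_i<0} KL(b_i* ‖ b_i^0) ). -/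

import Mathlib

open Finset

/-- Price of good `j` given spending `b`. -/
noncomputable def price {m n : ℕ} (b : Fin m → Fin n → ℝ) (j : Fin n) : ℝ :=
  ∑ i, b i j

/-- KL divergence between two nonnegative vectors. -/
noncomputable def KL {n : ℕ} (x y : Fin n → ℝ) : ℝ :=
  ∑ j, x j * Real.log (x j / y j)

/-- Feasible spending: nonnegative entries, each buyer spends exactly her budget. -/
def Feasible {m n : ℕ} (e : Fin m → ℝ) (b : Fin m → Fin n → ℝ) : Prop :=
  ∀ i, (∀ j, 0 ≤ b i j) ∧ ∑ j, b i j = e i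

/-- `mix S b b'` takes buyer `i`'s spending from `b` when `i ∈ S`, else from `b'`. -/
def mix {m n : ℕ} (S : Finset (Fin m)) (b b' : Fin m → Fin n → ℝ) :
    Fin m → Fin n → ℝ :=
  fun i => if i ∈ S then b i else b' i

/-- The potential `Φ`, where `S` is the set of buyers with `ρ_i ≠ 0` and its
complement consists of the Cobb-Douglas buyers (`ρ_i = 0`), who contribute the
term `Σ_j b_ij log p_j(b)`. -/
noncomputable def PhiCD {m n : ℕ} (S : Finset (Fin m))
    (a : Fin m → Fin n → ℝ) (ρ : Fin m → ℝ) (b : Fin m → Fin n → ℝ) : ℝ :=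
  (-∑ i ∈ S,
      (1 / ρ i) * ∑ j, b i j * Real.log (a i j * b i j ^ (ρ i - 1) / price b j ^ ρ i)) +
    ∑ i ∈ Sᶜ, ∑ j, b i j * Real.log (price b j)

lemma sub_le_mul_log_div {x y : ℝ} (hx : 0 ≤ x) (hy : 0 < y) :
    x - y ≤ x * Real.log (x / y) := by
  rcases hx.eq_or_lt with rfl | hx
  · simpa using hy.le
  · have h := mul_le_mul_of_nonneg_left (Real.one_sub_inv_le_log_of_pos (div_pos hx hy)) hx.le
    have h' : x * (1 - (x / y)⁻¹) = x - y := by field_simp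
    linarith

lemma mul_log_div_eq {x y : ℝ} (hy : y ≠ 0) :
    x * Real.log (x / y) = x * (Real.log x - Real.log y) := by
  rcases eq_or_ne x 0 with rfl | hx
  · simp
  · rw [Real.log_div hx hy]

lemma KL_nonneg {n : ℕ} {x y : Fin n → ℝ} (hx : ∀ j, 0 ≤ x j) (hy : ∀ j, 0 < y j)
    (hxy : ∑ j, x j = ∑ j, y j) : 0 ≤ KL x y := by
  have h : ∑ j, (x j - y j) ≤ KL x y :=
    sum_le_sum fun j _ => sub_le_mul_log_div (hx j) (hy j)
  rw [sum_sub_distrib, hxy, sub_self] at h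
  exact h

lemma KL_self {n : ℕ} (x : Fin n → ℝ) : KL x x = 0 := by
  refine sum_eq_zero fun j _ => ?_
  rcases eq_or_ne (x j) 0 with h | h <;> simp [h]

/-- The log-sum inequality. -/
lemma sum_mul_log_sum_div_sum_le {ι : Type*} (s : Finset ι) {x y : ι → ℝ}
    (hx : ∀ i ∈ s, 0 ≤ x i) (hy : ∀ i ∈ s, 0 < y i) :
    (∑ i ∈ s, x i) * Real.log ((∑ i ∈ s, x i) / ∑ i ∈ s, y i) ≤
      ∑ i ∈ s, x i * Real.log (x i / y i) := by
  rcases (sum_nonneg hx).eq_or_lt with h | hX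
  · have h0 := (sum_eq_zero_iff_of_nonneg hx).1 h.symm
    rw [← h, zero_mul]
    exact (sum_eq_zero fun i hi => by rw [h0 i hi, zero_mul]).ge
  have hs : s.Nonempty := nonempty_of_sum_ne_zero hX.ne'
  have hY : 0 < ∑ i ∈ s, y i := sum_pos hy hs
  set X := ∑ i ∈ s, x i with hXdef
  set Y := ∑ i ∈ s, y i with hYdef
  have key : ∀ i ∈ s, x i * Real.log (X / Y) + (x i - y i * (X / Y)) ≤
      x i * Real.log (x i / y i) := fun i hi => by
    have h := sub_le_mul_log_div (hx i hi) (mul_pos (hy i hi) (div_pos hX hY))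
    rw [mul_log_div_eq (mul_pos (hy i hi) (div_pos hX hY)).ne',
      Real.log_mul (hy i hi).ne' (div_pos hX hY).ne'] at h
    rw [mul_log_div_eq (hy i hi).ne']
    linarith
  have h := sum_le_sum key
  rw [sum_add_distrib, sum_sub_distrib, ← sum_mul, ← sum_mul, ← hXdef, ← hYdef,
    mul_div_cancel₀ _ hY.ne', sub_self, add_zero] at h
  exact h

lemma price_pos {m n : ℕ} [Nonempty (Fin m)] {b : Fin m → Fin n → ℝ}
    (hb : ∀ i j, 0 < b i j) (j : Fin n) : 0 < price b j :=
  sum_pos (fun i _ => hb i j) univ_nonempty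

lemma KL_price_le {m n : ℕ} {x y : Fin m → Fin n → ℝ}
    (hx : ∀ i j, 0 ≤ x i j) (hy : ∀ i j, 0 < y i j) :
    KL (price x) (price y) ≤ ∑ i, KL (x i) (y i) := by
  simp only [KL]
  rw [sum_comm]
  exact sum_le_sum fun j _ =>
    sum_mul_log_sum_div_sum_le univ (fun i _ => hx i j) (fun i _ => hy i j)

lemma sum_price {m n : ℕ} {e : Fin m → ℝ} {b : Fin m → Fin n → ℝ} (hb : Feasible e b) :
    ∑ j, price b j = ∑ i, e i := by
  simp only [price]
  rw [sum_comm]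
  exact sum_congr rfl fun i _ => (hb i).2

lemma Feasible.mix {m n : ℕ} {e : Fin m → ℝ} {b b' : Fin m → Fin n → ℝ} (S : Finset (Fin m))
    (hb : Feasible e b) (hb' : Feasible e b') : Feasible e (mix S b b') := by
  intro i
  by_cases hi : i ∈ S
  · simpa [_root_.mix, hi] using hb i
  · simpa [_root_.mix, hi] using hb' i

/-- The potential with the prices frozen at `q`; see `PhiCD_eq_PhiAt_price`. -/
noncomputable def PhiAt {m n : ℕ} (S : Finset (Fin m))
    (a : Fin m → Fin n → ℝ) (ρ : Fin m → ℝ) (q : Fin n → ℝ) (b : Fin m → Fin n → ℝ) : ℝ :=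
  ∑ i ∈ S, ∑ j, b i j *
      (Real.log (q j) - Real.log (a i j) / ρ i - (ρ i - 1) / ρ i * Real.log (b i j)) +
    ∑ i ∈ Sᶜ, ∑ j, b i j * Real.log (q j)

section PhiAt

variable {m n : ℕ} {S : Finset (Fin m)} {a : Fin m → Fin n → ℝ} {ρ : Fin m → ℝ}

lemma PhiCD_eq_PhiAt_price (ha : ∀ i j, 0 < a i j) (hρ : ∀ i ∈ S, ρ i < 0)
    {b : Fin m → Fin n → ℝ} (hb : ∀ i j, 0 ≤ b i j) :
    PhiCD S a ρ b = PhiAt S a ρ (price b) b := by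
  rw [PhiCD, PhiAt, ← sum_neg_distrib]
  congr 1
  refine sum_congr rfl fun i hi => ?_
  rw [mul_sum, ← sum_neg_distrib]
  refine sum_congr rfl fun j _ => ?_
  rcases (hb i j).eq_or_lt with h | h
  · simp [← h]
  have hp : 0 < price b j :=
    h.trans_le (single_le_sum (f := fun i => b i j) (fun i _ => hb i j) (mem_univ i))
  have hr := (hρ i hi).ne
  rw [Real.log_div (mul_pos (ha i j) (Real.rpow_pos_of_pos h _)).ne'
      (Real.rpow_pos_of_pos hp _).ne',
    Real.log_mul (ha i j).ne' (Real.rpow_pos_of_pos h _).ne', Real.log_rpow h, Real.log_rpow hp]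
  field_simp
  ring

lemma PhiAt_price_sub {b : Fin m → Fin n → ℝ} {q : Fin n → ℝ} (hq : ∀ j, 0 < q j) :
    PhiAt S a ρ (price b) b - PhiAt S a ρ q b = KL (price b) q := by
  have h : KL (price b) q =
      ∑ i, ∑ j, b i j * (Real.log (price b j) - Real.log (q j)) := by
    rw [sum_comm]
    refine sum_congr rfl fun j _ => ?_
    rw [mul_log_div_eq (hq j).ne', ← sum_mul, price]
  rw [h, ← sum_add_sum_compl S, PhiAt, PhiAt, add_sub_add_comm]
  simp only [← sum_sub_distrib]
  congr 1 <;> refine sum_congr rfl fun i _ => sum_congr rfl fun j _ => by ring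

/-- The Bregman identity for one buyer's proportional response `u` to the prices `q`. -/
lemma sum_mul_log_sub_eq_sub_KL {r E : ℝ} (hr : r < 0) (hE : 0 < E)
    {α q x u : Fin n → ℝ} (hα : ∀ j, 0 < α j) (hq : ∀ j, 0 < q j) (hx : ∑ j, x j = E)
    (hu : ∀ j, u j = E * (α j / q j ^ r) ^ (1 / (1 - r)) /
      ∑ k, (α k / q k ^ r) ^ (1 / (1 - r))) :
    ∑ j, x j * (Real.log (q j) - Real.log (α j) / r - (r - 1) / r * Real.log (x j)) =
      (r - 1) / r * (E * Real.log ((∑ k, (α k / q k ^ r) ^ (1 / (1 - r))) / E)) -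
        (r - 1) / r * KL x u := by
  have hc : ∀ j, 0 < (α j / q j ^ r) ^ (1 / (1 - r)) := fun j =>
    Real.rpow_pos_of_pos (div_pos (hα j) (Real.rpow_pos_of_pos (hq j) _)) _
  have hne : (univ : Finset (Fin n)).Nonempty :=
    nonempty_of_sum_ne_zero (hx.trans_ne hE.ne')
  have hZ : 0 < ∑ k, (α k / q k ^ r) ^ (1 / (1 - r)) := sum_pos (fun j _ => hc j) hne
  set Z := ∑ k, (α k / q k ^ r) ^ (1 / (1 - r))
  rw [← hx, sum_mul, KL, mul_sum, mul_sum, ← sum_sub_distrib, hx]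
  refine sum_congr rfl fun j _ => ?_
  have hupos : 0 < u j := by rw [hu j]; exact div_pos (mul_pos hE (hc j)) hZ
  have hr1 : 1 - r ≠ 0 := by linarith
  have hr0 := hr.ne
  rw [mul_log_div_eq hupos.ne', hu j, Real.log_div (mul_pos hE (hc j)).ne' hZ.ne',
    Real.log_mul hE.ne' (hc j).ne', Real.log_div hZ.ne' hE.ne',
    Real.log_rpow (div_pos (hα j) (Real.rpow_pos_of_pos (hq j) _)),
    Real.log_div (hα j).ne' (Real.rpow_pos_of_pos (hq j) _).ne', Real.log_rpow (hq j)]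
  field_simp
  ring

lemma PhiAt_mix_sub {e : Fin m → ℝ} (he : ∀ i, 0 < e i) (ha : ∀ i j, 0 < a i j)
    (hρ : ∀ i ∈ S, ρ i < 0) {q : Fin n → ℝ} (hq : ∀ j, 0 < q j)
    {u x : Fin m → Fin n → ℝ} (hu : Feasible e u) (hx : Feasible e x)
    (hresp : ∀ i ∈ S, ∀ j, u i j = e i * (a i j / q j ^ ρ i) ^ (1 / (1 - ρ i)) /
      ∑ k, (a i k / q k ^ ρ i) ^ (1 / (1 - ρ i))) :
    PhiAt S a ρ q (mix S u x) - PhiAt S a ρ q x =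
      ∑ i ∈ S, (ρ i - 1) / ρ i * KL (x i) (u i) := by
  rw [PhiAt, PhiAt, add_sub_add_comm]
  have h0 : ∑ i ∈ Sᶜ, ∑ j, mix S u x i j * Real.log (q j) =
      ∑ i ∈ Sᶜ, ∑ j, x i j * Real.log (q j) :=
    sum_congr rfl fun i hi => by simp [mix, mem_compl.1 hi]
  rw [h0, sub_self, add_zero, ← sum_sub_distrib]
  refine sum_congr rfl fun i hi => ?_
  simp only [mix, if_pos hi]
  rw [sum_mul_log_sub_eq_sub_KL (hρ i hi) (he i) (ha i) hq (hu i).2 (hresp i hi),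
    sum_mul_log_sub_eq_sub_KL (hρ i hi) (he i) (ha i) hq (hx i).2 (hresp i hi), KL_self]
  ring

end PhiAt

/-- Summing a geometrically contracting descent inequality along a monotone sequence of gaps. -/
lemma le_mul_of_descent {σ : ℝ} (hσ : 1 < σ) {δ D : ℕ → ℝ} (hD : ∀ t, 0 ≤ D t)
    (hstep : ∀ t, δ (t + 1) ≤ D t - σ * D (t + 1)) (hmono : ∀ t, 1 ≤ t → δ (t + 1) ≤ δ t)
    {T : ℕ} (hT : 1 ≤ T) : δ T ≤ (σ - 1) / (σ ^ T - 1) * D 0 := by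
  have key : ∀ t, (σ ^ t - 1) * δ t + (σ - 1) * σ ^ t * D t ≤ (σ - 1) * D 0 := by
    intro t
    induction t with
    | zero => simp
    | succ t ih =>
      have h1 : (σ ^ t - 1) * δ (t + 1) ≤ (σ ^ t - 1) * δ t := by
        rcases Nat.eq_zero_or_pos t with rfl | ht
        · simp
        · exact mul_le_mul_of_nonneg_left (hmono t ht)
            (sub_nonneg.2 (one_le_pow₀ hσ.le))
      have h2 := mul_le_mul_of_nonneg_left (hstep t)
        (mul_nonneg (sub_nonneg.2 hσ.le) (pow_nonneg (zero_le_one.trans hσ.le) t))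
      rw [pow_succ]
      linarith
  have hpos : 0 < σ ^ T - 1 := sub_pos.2 (one_lt_pow₀ hσ (by lia))
  have h3 : 0 ≤ (σ - 1) * σ ^ T * D T :=
    mul_nonneg (mul_nonneg (sub_nonneg.2 hσ.le) (pow_nonneg (zero_le_one.trans hσ.le) T)) (hD T)
  rw [div_mul_eq_mul_div, le_div_iff₀ hpos]
  linarith [key T]

/-- Linear convergence of the complementary Proportional Response
with strict complements buyers (`N`, `-∞ < ρ_i < 0`) and Cobb-Douglas buyers
(`ρ_i = 0`), the latter jumping directly to their equilibrium spending
`b*_ij = e_i a_ij`; here `σ = min_{i : ρ_i < 0} (ρ_i - 1)/ρ_i > 1`. -/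
theorem proportional_response_complements_with_cobb_douglas_linear {m n : ℕ}
    (N : Finset (Fin m))
    (e : Fin m → ℝ) (he : ∀ i, 0 < e i)
    (a : Fin m → Fin n → ℝ) (ha : ∀ i j, 0 < a i j)
    (ρ : Fin m → ℝ) (hρ : ∀ i, ρ i ≤ 0)
    (hN : ∀ i, i ∈ N ↔ ρ i < 0)
    (hCD : ∀ i ∉ N, ∑ j, a i j = 1)
    (b : ℕ → Fin m → Fin n → ℝ)
    (hb0pos : ∀ i j, 0 < b 0 i j) (hb0 : Feasible e (b 0))
    -- the update rules
    (hupdNeg : ∀ t, ∀ i ∈ N, ∀ j, b (t + 1) i j =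
      e i * (a i j / price (b t) j ^ ρ i) ^ (1 / (1 - ρ i)) /
        ∑ k, (a i k / price (b t) k ^ ρ i) ^ (1 / (1 - ρ i)))
    (hupdCD : ∀ t, ∀ i ∉ N, ∀ j, b (t + 1) i j = e i * a i j)
    -- σ = min_{i ∈ N} (ρ_i - 1)/ρ_i, and σ > 1
    (σ : ℝ) (hσgt : 1 < σ)
    (hσle : ∀ i ∈ N, σ ≤ (ρ i - 1) / ρ i) (hσmem : ∃ i ∈ N, σ = (ρ i - 1) / ρ i)
    -- b* : Cobb-Douglas buyers at equilibrium, and b*_{<0} maximizes Φ(b*_{=0}, ·)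
    (bstar : Fin m → Fin n → ℝ) (hbstarFeas : Feasible e bstar)
    (hbstarCD : ∀ i ∉ N, ∀ j, bstar i j = e i * a i j)
    (hbstarMax : ∀ b', Feasible e b' →
      PhiCD N a ρ (mix N b' bstar) ≤ PhiCD N a ρ bstar)
    (T : ℕ) (hT : 1 ≤ T) :
    PhiCD N a ρ bstar - PhiCD N a ρ (mix N (b T) bstar) ≤
      (σ - 1) / (σ ^ T - 1) *
        ((∑ i ∈ Nᶜ, KL (bstar i) (b 0 i)) + ∑ i ∈ N, KL (bstar i) (b 0 i)) := by
  have hρN : ∀ i ∈ N, ρ i < 0 := fun i hi => (hN i).1 hi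
  obtain ⟨i₀, -, -⟩ := hσmem
  have : Nonempty (Fin m) := ⟨i₀⟩
  have hn : (univ : Finset (Fin n)).Nonempty :=
    nonempty_of_sum_ne_zero ((hb0 i₀).2.trans_ne (he i₀).ne')
  have hpos : ∀ t i j, 0 < b t i j := by
    intro t
    induction t with
    | zero => exact hb0pos
    | succ t ih =>
      intro i j
      by_cases hi : i ∈ N
      · have hc : ∀ k, 0 < (a i k / price (b t) k ^ ρ i) ^ (1 / (1 - ρ i)) := fun k =>
          Real.rpow_pos_of_pos
            (div_pos (ha i k) (Real.rpow_pos_of_pos (price_pos ih k) _)) _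
        rw [hupdNeg t i hi j]
        exact div_pos (mul_pos (he i) (hc j)) (sum_pos (fun k _ => hc k) hn)
      · rw [hupdCD t i hi j]
        exact mul_pos (he i) (ha i j)
  have hfeas : ∀ t, Feasible e (b t) := by
    rintro (_ | t)
    · exact hb0
    refine fun i => ⟨fun j => (hpos _ i j).le, ?_⟩
    by_cases hi : i ∈ N
    · have hc : ∀ k, 0 < (a i k / price (b t) k ^ ρ i) ^ (1 / (1 - ρ i)) := fun k =>
        Real.rpow_pos_of_pos
          (div_pos (ha i k) (Real.rpow_pos_of_pos (price_pos (hpos t) k) _)) _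
      simp only [hupdNeg t i hi]
      rw [← sum_div, ← mul_sum, mul_div_cancel_right₀]
      exact (sum_pos (fun k _ => hc k) hn).ne'
    · simp only [hupdCD t i hi]
      rw [← mul_sum, hCD i hi, mul_one]
  have hmix : ∀ t, mix N (b (t + 1)) bstar = b (t + 1) := by
    intro t
    ext i j
    by_cases hi : i ∈ N
    · simp [mix, hi]
    · simp [mix, hi, hbstarCD i hi j, hupdCD t i hi j]
  have hKL : ∀ {x : Fin m → Fin n → ℝ}, Feasible e x → ∀ t i, 0 ≤ KL (x i) (b t i) :=
    fun hx t i => KL_nonneg (hx i).1 (hpos t i) ((hx i).2.trans (hfeas t i).2.symm)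
  have hs : ∀ i ∈ N, 0 ≤ (ρ i - 1) / ρ i := fun i hi =>
    (zero_le_one.trans hσgt.le).trans (hσle i hi)
  have hPhi : ∀ {x : Fin m → Fin n → ℝ}, Feasible e x → ∀ t,
      PhiCD N a ρ x = PhiAt N a ρ (price (b t)) x + KL (price x) (price (b t)) := by
    intro x hx t
    rw [PhiCD_eq_PhiAt_price ha hρN fun i => (hx i).1,
      ← PhiAt_price_sub (S := N) (a := a) (ρ := ρ) (price_pos (hpos t))]
    ring
  have hdescent : ∀ {x : Fin m → Fin n → ℝ}, Feasible e x → ∀ t,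
      PhiCD N a ρ x + ∑ i ∈ N, (ρ i - 1) / ρ i * KL (x i) (b (t + 1) i) ≤
        PhiCD N a ρ (mix N (b (t + 1)) x) + KL (price x) (price (b t)) := by
    intro x hx t
    have hm := (hfeas (t + 1)).mix N hx
    have h1 := PhiAt_mix_sub he ha hρN (price_pos (hpos t)) (hfeas (t + 1)) hx (hupdNeg t)
    have h2 : 0 ≤ KL (price (mix N (b (t + 1)) x)) (price (b t)) :=
      KL_nonneg (fun j => sum_nonneg fun i _ => (hm i).1 j) (price_pos (hpos t))
        ((sum_price hm).trans (sum_price (hfeas t)).symm)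
    linarith [hPhi hx t, hPhi hm t]
  rw [add_comm (∑ i ∈ Nᶜ, KL (bstar i) (b 0 i)), sum_add_sum_compl]
  refine le_mul_of_descent (δ := fun t => PhiCD N a ρ bstar - PhiCD N a ρ (mix N (b t) bstar))
    (D := fun t => ∑ i, KL (bstar i) (b t i)) hσgt
    (fun t => sum_nonneg fun i _ => hKL hbstarFeas t i) (fun t => ?_) (fun t ht => ?_) hT
  · have h1 := hdescent hbstarFeas t
    have h2 := KL_price_le (fun i => (hbstarFeas i).1) (hpos t)
    have h3 : ∑ i, KL (bstar i) (b (t + 1) i) = ∑ i ∈ N, KL (bstar i) (b (t + 1) i) := by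
      refine (sum_subset (subset_univ N) fun i _ hi => ?_).symm
      have : bstar i = b (t + 1) i :=
        funext fun j => (hbstarCD i hi j).trans (hupdCD t i hi j).symm
      rw [this, KL_self]
    have h4 : σ * ∑ i ∈ N, KL (bstar i) (b (t + 1) i) ≤
        ∑ i ∈ N, (ρ i - 1) / ρ i * KL (bstar i) (b (t + 1) i) := by
      rw [mul_sum]
      exact sum_le_sum fun i hi =>
        mul_le_mul_of_nonneg_right (hσle i hi) (hKL hbstarFeas (t + 1) i)
    simp only [h3]
    linarith
  · obtain ⟨s, rfl⟩ := Nat.exists_eq_add_of_le' ht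
    have h1 := hdescent (hfeas (s + 1)) (s + 1)
    have h2 : mix N (b (s + 1 + 1)) (b (s + 1)) = b (s + 1 + 1) := by
      ext i j
      by_cases hi : i ∈ N
      · simp [mix, hi]
      · simp [mix, hi, hupdCD _ i hi j]
    have h3 : 0 ≤ ∑ i ∈ N, (ρ i - 1) / ρ i * KL (b (s + 1) i) (b (s + 1 + 1) i) :=
      sum_nonneg fun i hi => mul_nonneg (hs i hi) (hKL (hfeas (s + 1)) (s + 2) i)
    rw [h2, KL_self] at h1
    simp only [hmix]
    linarith
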